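/- Let A be a normed ring, and let B be a metrizable topological abelian group carrying an (A,A)-bimodule structure such that for each a ∈ A the maps ξ ↦ a·ξ and ξ ↦ ξ·a are continuous on B, and for each ξ ∈ B the maps a ↦ a·ξ and a ↦ ξ·a are continuous from the norm topology of A to B. Let D : A → B be a derivation. Then the range of discontinuity d(D) := { ξ ∈ B : there exists a sequence (xₙ) in A with ‖xₙ‖ → 0 and D(xₙ) → ξ } is a closed sub-bimodule of B, i.e. it is a closed subgroup of B stable under the left and right A-actions. -/

import Mathlib

open MulOpposite Filter

/-- The range of discontinuity of a map `D` from a normed ring to a topological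
space: the set of limits of `D` along sequences tending to `0` in norm. -/
def rangeOfDiscontinuity {A B : Type*} [Norm A] [TopologicalSpace B] (D : A → B) : Set B :=
  {ξ : B | ∃ x : ℕ → A,
    Tendsto (fun n => ‖x n‖) atTop (nhds 0) ∧ Tendsto (fun n => D (x n)) atTop (nhds ξ)}

/-- The range of discontinuity is the fibre over `0` of the closure of the graph. -/
lemma mem_rangeOfDiscontinuity_iff {A B : Type*} [SeminormedAddCommGroup A] [TopologicalSpace B]
    [FirstCountableTopology B] {D : A → B} {ξ : B} :
    ξ ∈ rangeOfDiscontinuity D ↔ ((0 : A), ξ) ∈ closure (Set.range fun x => (x, D x)) := by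
  rw [mem_closure_iff_seq_limit]
  constructor
  · rintro ⟨x, hx, hD⟩
    exact ⟨fun n => (x n, D (x n)), fun n => ⟨x n, rfl⟩,
      (tendsto_zero_iff_norm_tendsto_zero.2 hx).prodMk_nhds hD⟩
  · rintro ⟨p, hp, hlim⟩
    choose x hx using hp
    obtain rfl : (fun n => (x n, D (x n))) = p := funext hx
    exact ⟨x, tendsto_zero_iff_norm_tendsto_zero.1 hlim.fst_nhds, hlim.snd_nhds⟩

lemma isClosed_rangeOfDiscontinuity {A B : Type*} [SeminormedAddCommGroup A] [TopologicalSpace B]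
    [FirstCountableTopology B] (D : A → B) : IsClosed (rangeOfDiscontinuity D) := by
  have h : rangeOfDiscontinuity D =
      (fun ξ : B => ((0 : A), ξ)) ⁻¹' closure (Set.range fun x => (x, D x)) :=
    Set.ext fun _ => mem_rangeOfDiscontinuity_iff
  rw [h]
  exact isClosed_closure.preimage (by fun_prop)

/-- Membership in the range of discontinuity, with convergence to `0` in the topology of `A`. -/
lemma mem_rangeOfDiscontinuity_iff_exists_seq {A B : Type*} [SeminormedAddCommGroup A]
    [TopologicalSpace B] {D : A → B} {ξ : B} :
    ξ ∈ rangeOfDiscontinuity D ↔ ∃ x : ℕ → A,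
      Tendsto x atTop (nhds 0) ∧ Tendsto (fun n => D (x n)) atTop (nhds ξ) := by
  simp only [tendsto_zero_iff_norm_tendsto_zero (E := A)]
  rfl

/-- For a derivation `D` from a normed ring `A` into a metrizable topological
abelian group `B` carrying a separately continuous `(A,A)`-bimodule structure,
the range of discontinuity `d(D)` is a closed sub-bimodule of `B`: a closed
subgroup stable under the left and right `A`-actions. -/
theorem rangeOfDiscontinuity_closed_subbimodule {A B : Type*} [NormedRing A]
    [AddCommGroup B] [TopologicalSpace B] [IsTopologicalAddGroup B]
    [TopologicalSpace.MetrizableSpace B]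
    [Module A B] [Module Aᵐᵒᵖ B] [SMulCommClass A Aᵐᵒᵖ B]
    (hcontl : ∀ a : A, Continuous fun ξ : B => a • ξ)
    (hcontr : ∀ a : A, Continuous fun ξ : B => op a • ξ)
    (hcontl' : ∀ ξ : B, Continuous fun a : A => a • ξ)
    (hcontr' : ∀ ξ : B, Continuous fun a : A => op a • ξ)
    (D : A → B)
    (hadd : ∀ x y : A, D (x + y) = D x + D y)
    (hleib : ∀ x y : A, D (x * y) = x • D y + op y • D x) :
    IsClosed (rangeOfDiscontinuity D) ∧
    (0 : B) ∈ rangeOfDiscontinuity D ∧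
    (∀ ξ η : B, ξ ∈ rangeOfDiscontinuity D → η ∈ rangeOfDiscontinuity D →
      ξ + η ∈ rangeOfDiscontinuity D) ∧
    (∀ ξ : B, ξ ∈ rangeOfDiscontinuity D → -ξ ∈ rangeOfDiscontinuity D) ∧
    (∀ (a : A) (ξ : B), ξ ∈ rangeOfDiscontinuity D → a • ξ ∈ rangeOfDiscontinuity D) ∧
    (∀ (a : A) (ξ : B), ξ ∈ rangeOfDiscontinuity D → op a • ξ ∈ rangeOfDiscontinuity D) := by
  let F : A →+ B := AddMonoidHom.mk' D hadd
  have hzero : D 0 = 0 := F.map_zero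
  have hneg (x : A) : D (-x) = -D x := F.map_neg x
  refine ⟨isClosed_rangeOfDiscontinuity D, ?_⟩
  simp only [mem_rangeOfDiscontinuity_iff_exists_seq]
  refine ⟨⟨fun _ => 0, tendsto_const_nhds, by simp [hzero]⟩, ?_, ?_, ?_, ?_⟩
  · rintro ξ η ⟨x, hx, hξ⟩ ⟨y, hy, hη⟩
    exact ⟨fun n => x n + y n, by simpa using hx.add hy, by simpa only [hadd] using hξ.add hη⟩
  · rintro ξ ⟨x, hx, hξ⟩
    exact ⟨fun n => -x n, by simpa using hx.neg, by simpa only [hneg] using hξ.neg⟩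
  · rintro a ξ ⟨x, hx, hξ⟩
    refine ⟨fun n => a * x n, by simpa using hx.const_mul a, ?_⟩
    have hr : Tendsto (fun n => op (x n) • D a) atTop (nhds 0) := by
      simpa [Function.comp_def] using ((hcontr' (D a)).tendsto 0).comp hx
    simpa only [Function.comp_def, hleib, add_zero] using (((hcontl a).tendsto ξ).comp hξ).add hr
  · rintro a ξ ⟨x, hx, hξ⟩
    refine ⟨fun n => x n * a, by simpa using hx.mul_const a, ?_⟩
    have hl : Tendsto (fun n => x n • D a) atTop (nhds 0) := by
      simpa [Function.comp_def] using ((hcontl' (D a)).tendsto 0).comp hx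
    simpa only [Function.comp_def, hleib, zero_add] using hl.add (((hcontr a).tendsto ξ).comp hξ)
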